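/- Let A be a finite alphabet with at least two letters, u ∈ A⁺ a nonempty word, π a permutation of A, w a prefix of Pal(u), and let σ be the w-conjugate of ψ_u ∘ π; assume σ is primitive. Then for every word v ∈ L(σ) and all distinct left return words r ≠ s in R(v) (return sets taken in the language L(σ)): |gcs(σ(r)·σ(s), σ(s)·σ(r))| ≥ |w|, with equality if and only if v is left special in L(σ). -/

import Mathlib

open List

section EpiDefs

variable {A : Type*}

/-- The episturmian generator ψ_a : a ↦ a, b ↦ ab for b ≠ a, as a map on words. -/
def psiL [DecidableEq A] (a : A) : List A → List A :=
  fun u => (u.map (fun b => if b = a then [a] else [a, b])).flatten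

/-- The episturmian generator ψ̄_a : a ↦ a, b ↦ ba for b ≠ a, as a map on words. -/
def psibarL [DecidableEq A] (a : A) : List A → List A :=
  fun u => (u.map (fun b => if b = a then [a] else [b, a])).flatten

/-- ψ_{u₁⋯uₙ} = ψ_{u₁} ∘ ⋯ ∘ ψ_{uₙ}. -/
def psiW [DecidableEq A] (u : List A) : List A → List A :=
  u.foldr (fun a f => psiL a ∘ f) id

/-- ψ̄_{u₁⋯uₙ} = ψ̄_{u₁} ∘ ⋯ ∘ ψ̄_{uₙ}. -/
def psibarW [DecidableEq A] (u : List A) : List A → List A :=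
  u.foldr (fun a f => psibarL a ∘ f) id

/-- There is a shortest palindrome having `x` as a prefix. -/
theorem exists_isPalClosure (x : List A) :
    ∃ p : List A, (p.reverse = p ∧ x <+: p) ∧
      ∀ q : List A, q.reverse = q → x <+: q → p.length ≤ q.length := by
  classical
  have hex : ∃ n : ℕ, ∃ p : List A, (p.reverse = p ∧ x <+: p) ∧ p.length = n :=
    ⟨(x ++ x.reverse).length, x ++ x.reverse, ⟨by simp, ⟨x.reverse, rfl⟩⟩, rfl⟩
  obtain ⟨p, hp, hlen⟩ := Nat.find_spec hex
  refine ⟨p, hp, fun q h1 h2 => ?_⟩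
  rw [hlen]
  exact Nat.find_le ⟨q, ⟨h1, h2⟩, rfl⟩

/-- `palPlus x = x⁽⁺⁾` is the shortest palindrome having `x` as a prefix. -/
noncomputable def palPlus (x : List A) : List A :=
  Classical.choose (exists_isPalClosure x)

/-- Iterated palindromic closure: Pal(ε) = ε, Pal(ua) = (Pal(u)a)⁽⁺⁾. -/
noncomputable def pal (u : List A) : List A :=
  u.foldl (fun p a => palPlus (p ++ [a])) []

/-- Longest common prefix. -/
def gcp [DecidableEq A] : List A → List A → List A
  | a :: x, b :: y => if a = b then a :: gcp x y else []
  | _, _ => []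

/-- Longest common suffix. -/
def gcs [DecidableEq A] (x y : List A) : List A :=
  (gcp x.reverse y.reverse).reverse

/-- The language of a (primitive) substitution: factors of σⁿ(a). -/
def LangS (σ : List A → List A) : Set (List A) :=
  {x | ∃ (n : ℕ) (a : A), x <:+: σ^[n] [a]}

/-- The language of the episturmian shift directed by `d`. -/
def LangD (d : ℕ → A) : Set (List A) :=
  {x | ∃ n : ℕ, x <:+: pal ((List.range n).map d)}

def LeftSpecial (L : Set (List A)) (v : List A) : Prop :=
  ∃ a b : A, a ≠ b ∧ a :: v ∈ L ∧ b :: v ∈ L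

def RightSpecial (L : Set (List A)) (v : List A) : Prop :=
  ∃ a b : A, a ≠ b ∧ v ++ [a] ∈ L ∧ v ++ [b] ∈ L

/-- The left return set of `u` in the language `L`. -/
def leftReturn (L : Set (List A)) (u : List A) : Set (List A) :=
  {r | r ++ u ∈ L ∧ (∃ s : List A, s ≠ [] ∧ r ++ u = u ++ s) ∧
    ¬∃ p q : List A, p ≠ [] ∧ q ≠ [] ∧ r ++ u = p ++ u ++ q}

/-- The right return set of `u` in the language `L`. -/
def rightReturn (L : Set (List A)) (u : List A) : Set (List A) :=
  {r | u ++ r ∈ L ∧ (∃ p : List A, p ≠ [] ∧ u ++ r = p ++ u) ∧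
    ¬∃ p q : List A, p ≠ [] ∧ q ≠ [] ∧ u ++ r = p ++ u ++ q}

/-- `σ` is an endomorphism of the free monoid A*. -/
def IsListHom (σ : List A → List A) : Prop :=
  ∀ x y : List A, σ (x ++ y) = σ x ++ σ y

/-- Primitivity of a substitution. -/
def IsPrimitiveSubst (σ : List A → List A) : Prop :=
  ∃ k : ℕ, 1 ≤ k ∧ ∀ a b : A, b ∈ σ^[k] [a]

/-- At least two distinct letters occur infinitely often in `d`. -/
def NonDegenerate (d : ℕ → A) : Prop :=
  ∃ a b : A, a ≠ b ∧ (∀ N : ℕ, ∃ n : ℕ, N ≤ n ∧ d n = a) ∧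
    (∀ N : ℕ, ∃ n : ℕ, N ≤ n ∧ d n = b)

end EpiDefs

section Helpers

variable {A : Type*}

theorem psiL_cons [DecidableEq A] (a b : A) (x : List A) :
    psiL a (b :: x) = (if b = a then [a] else [a, b]) ++ psiL a x := by
  simp [psiL]

theorem psiL_nil [DecidableEq A] (a : A) : psiL a [] = [] := rfl

theorem psiL_append [DecidableEq A] (a : A) (x y : List A) :
    psiL a (x ++ y) = psiL a x ++ psiL a y := by
  simp [psiL]

theorem psiW_cons [DecidableEq A] (a : A) (u x : List A) :
    psiW (a :: u) x = psiL a (psiW u x) := rfl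

theorem psiW_append [DecidableEq A] (u x y : List A) :
    psiW u (x ++ y) = psiW u x ++ psiW u y := by
  induction u with
  | nil => rfl
  | cons a u ih => simp only [psiW_cons, ih, psiL_append]

theorem psiL_last [DecidableEq A] (a : A) (x : List A) (b : A) :
    ∃ x', psiL a (x ++ [b]) = x' ++ [b] := by
  rw [psiL_append, psiL_cons, psiL_nil]
  by_cases h : b = a
  · exact ⟨psiL a x, by simp [h]⟩
  · exact ⟨psiL a x ++ [a], by simp [h]⟩

theorem psiW_last [DecidableEq A] (u : List A) : ∀ (x : List A) (b : A),
    ∃ x', psiW u (x ++ [b]) = x' ++ [b] := by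
  induction u with
  | nil => intro x b; exact ⟨x, rfl⟩
  | cons a u ih =>
    intro x b
    obtain ⟨x', hx'⟩ := ih x b
    rw [psiW_cons, hx']
    exact psiL_last a x' b


theorem psiL_head [DecidableEq A] {a t : A} {m q : List A} (h : psiL a m = t :: q) : t = a := by
  cases m with
  | nil => simp [psiL_nil] at h
  | cons b m =>
    rw [psiL_cons] at h
    split_ifs at h <;> simp at h <;> exact h.1.symm

theorem psiL_split [DecidableEq A] (a e : A) (x : List A) : ∀ (m p : List A),
    psiL a m = p ++ e :: x →
    (∃ m1 m2, m = m1 ++ e :: m2 ∧ psiL a m2 = x) ∨ (e = a ∧ ∃ t y, x = t :: y ∧ t ≠ a) := by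
  intro m
  induction m with
  | nil => intro p h; simp [psiL_nil] at h
  | cons b m ih =>
    intro p h
    rw [psiL_cons] at h
    by_cases hb : b = a
    · rw [if_pos hb] at h
      cases p with
      | nil =>
        simp at h
        exact Or.inl ⟨[], m, by simp [hb, h.1], h.2⟩
      | cons p0 p =>
        simp at h
        rcases ih p h.2 with ⟨m1, m2, h1, h2⟩ | h'
        · exact Or.inl ⟨b :: m1, m2, by simp [h1], h2⟩
        · exact Or.inr h'
    · rw [if_neg hb] at h
      cases p with
      | nil =>
        simp at h
        exact Or.inr ⟨h.1.symm, b, _, h.2.symm, hb⟩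
      | cons p0 p =>
        cases p with
        | nil =>
          simp at h
          exact Or.inl ⟨[], m, by simp [h.2.1], h.2.2⟩
        | cons p1 p =>
          simp at h
          rcases ih p h.2.2 with ⟨m1, m2, h1, h2⟩ | h'
          · exact Or.inl ⟨b :: m1, m2, by simp [h1], h2⟩
          · exact Or.inr h'

theorem psiL_prefix_a [DecidableEq A] {a : A} {y z : List A} (h : y <+: z) :
    psiL a y ++ [a] <+: psiL a z ++ [a] := by
  obtain ⟨t, rfl⟩ := h
  rw [psiL_append, List.append_assoc, List.prefix_append_right_inj]
  cases ht : psiL a t with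
  | nil => simp
  | cons c q => rw [psiL_head ht]; exact ⟨q ++ [a], by simp⟩

theorem psiL_decode [DecidableEq A] (a : A) : ∀ (m m' x : List A),
    x <+: psiL a m → x <+: psiL a m' →
    ∃ y, y <+: m ∧ y <+: m' ∧ x <+: psiL a y ++ [a] ∧ y.length ≤ x.length - 1 := by
  intro m
  induction m with
  | nil =>
    intro m' x h h'
    simp [psiL_nil] at h
    subst h
    exact ⟨[], by simp, by simp, by simp, by simp⟩
  | cons b m ih =>
    intro m' x h h'
    match x, h, h' with
    | [], _, _ => exact ⟨[], by simp, by simp, by simp, by simp⟩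
    | [t], h, _ =>
      obtain ⟨q, hq⟩ := h
      have : t = a := psiL_head (m := b :: m) (q := q) (by rw [← hq]; rfl)
      exact ⟨[], by simp, by simp, by simp [psiL_nil, this], by simp⟩
    | t :: t2 :: x, h, h' =>
      cases m' with
      | nil => simp [psiL_nil] at h'
      | cons b' m' =>
        rw [psiL_cons] at h h'
        by_cases hb : b = a
        · rw [if_pos hb] at h
          simp only [List.singleton_append, List.cons_prefix_cons] at h
          have ht2 : t2 = a := by
            obtain ⟨q, hq⟩ := h.2
            exact psiL_head (m := m) (q := x ++ q) (by rw [← hq]; rfl)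
          by_cases hb' : b' = a
          · rw [if_pos hb'] at h'
            simp only [List.singleton_append, List.cons_prefix_cons] at h'
            obtain ⟨y, h1, h2, h3, h4⟩ := ih m' (t2 :: x) h.2 h'.2
            refine ⟨a :: y, by simp [hb, h1], by simp [hb', h2], ?_, ?_⟩
            · rw [psiL_cons, if_pos rfl]
              simp only [List.singleton_append, List.cons_append, List.cons_prefix_cons]
              exact ⟨h.1, h3⟩
            · simp at h4 ⊢; omega
          · rw [if_neg hb'] at h'
            simp only [List.cons_append, List.cons_prefix_cons] at h'
            exact absurd (h'.2.1.symm.trans ht2) hb'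
        · rw [if_neg hb] at h
          simp only [List.cons_append, List.nil_append, List.cons_prefix_cons] at h
          have hbb : b' = b := by
            by_cases hb' : b' = a
            · rw [if_pos hb'] at h'
              simp only [List.singleton_append, List.cons_prefix_cons] at h'
              obtain ⟨q, hq⟩ := h'.2
              have : t2 = a := psiL_head (m := m') (q := x ++ q) (by rw [← hq]; rfl)
              exact absurd (h.2.1.symm.trans this) hb
            · rw [if_neg hb'] at h'
              simp only [List.cons_append, List.nil_append, List.cons_prefix_cons] at h'
              exact h'.2.1.symm.trans h.2.1
          subst hbb
          rw [if_neg hb] at h'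
          simp only [List.cons_append, List.nil_append, List.cons_prefix_cons] at h'
          obtain ⟨y, h1, h2, h3, h4⟩ := ih m' x h.2.2 h'.2.2
          refine ⟨b' :: y, by simp [h1], by simp [h2], ?_, ?_⟩
          · rw [psiL_cons, if_neg hb]
            simp only [List.cons_append, List.nil_append, List.cons_prefix_cons]
            exact ⟨h.1, h.2.1, h3⟩
          · simp at h4 ⊢; omega

/-- Factors of images. -/
def Img (f : List A → List A) (M : Set (List A)) : Set (List A) :=
  {x | ∃ m ∈ M, x <:+: f m}

def FacClosed (M : Set (List A)) : Prop := ∀ x y, x <:+: y → y ∈ M → x ∈ M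

theorem img_closed (f : List A → List A) (M : Set (List A)) : FacClosed (Img f M) := by
  rintro x y h ⟨m, hm, hinf⟩
  exact ⟨m, hm, h.trans hinf⟩

/-- Left special words of length at most `n` are comparable. -/
def ULS (M : Set (List A)) (n : ℕ) : Prop :=
  ∀ x y, LeftSpecial M x → LeftSpecial M y → x.length ≤ n → y.length ≤ n →
    (x <+: y ∨ y <+: x)

theorem leftSpecial_mono {M N : Set (List A)} (h : M ⊆ N) {x : List A}
    (hx : LeftSpecial M x) : LeftSpecial N x := by
  obtain ⟨a, b, hab, h1, h2⟩ := hx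
  exact ⟨a, b, hab, h h1, h h2⟩

theorem ULS_mono {M N : Set (List A)} (h : M ⊆ N) {n : ℕ} (hN : ULS N n) : ULS M n :=
  fun x y hx hy => hN x y (leftSpecial_mono h hx) (leftSpecial_mono h hy)

theorem leftSpecial_psiL [DecidableEq A] {M : Set (List A)} (hM : FacClosed M) (a : A)
    {x : List A} (hx : LeftSpecial (Img (psiL a) M) x) (hne : x ≠ []) :
    ∃ y, LeftSpecial M y ∧ y.length ≤ x.length - 1 ∧ x <+: psiL a y ++ [a] := by
  obtain ⟨e, f, hef, ⟨m, hm, p, q, h1⟩, ⟨m', hm', p', q', h2⟩⟩ := hx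
  have H1 := psiL_split a e (x ++ q) m p (by rw [← h1]; simp)
  have H2 := psiL_split a f (x ++ q') m' p' (by rw [← h2]; simp)
  cases x with
  | nil => exact absurd rfl hne
  | cons t x =>
    by_cases ht : t = a
    · have K1 : ∃ m1 m2, m = m1 ++ e :: m2 ∧ psiL a m2 = (t :: x) ++ q := by
        rcases H1 with h | ⟨_, t', y, h3, h4⟩
        · exact h
        · simp at h3; exact absurd (h3.1.symm.trans ht) h4
      have K2 : ∃ m1 m2, m' = m1 ++ f :: m2 ∧ psiL a m2 = (t :: x) ++ q' := by
        rcases H2 with h | ⟨_, t', y, h3, h4⟩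
        · exact h
        · simp at h3; exact absurd (h3.1.symm.trans ht) h4
      obtain ⟨m1, m2, rfl, h3⟩ := K1
      obtain ⟨n1, n2, rfl, h4⟩ := K2
      obtain ⟨y, ⟨c, rfl⟩, ⟨d, rfl⟩, h5, h6⟩ :=
        psiL_decode a m2 n2 (t :: x) ⟨q, h3.symm⟩ ⟨q', h4.symm⟩
      refine ⟨y, ⟨e, f, hef, hM _ _ ⟨m1, c, ?_⟩ hm, hM _ _ ⟨n1, d, ?_⟩ hm'⟩, h6, h5⟩ <;> simp
    · have K1 : e = a := by
        rcases H1 with ⟨m1, m2, _, h3⟩ | h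
        · exact absurd (psiL_head h3) ht
        · exact h.1
      have K2 : f = a := by
        rcases H2 with ⟨m1, m2, _, h3⟩ | h
        · exact absurd (psiL_head h3) ht
        · exact h.1
      exact absurd (K1.trans K2.symm) hef

theorem ULS_psiL [DecidableEq A] {M : Set (List A)} (hM : FacClosed M) (a : A) {n : ℕ}
    (h : ULS M n) : ULS (Img (psiL a) M) (n + 1) := by
  intro x y hx hy hxn hyn
  by_cases hx0 : x = []
  · left; simp [hx0]
  by_cases hy0 : y = []
  · right; simp [hy0]
  obtain ⟨x', h1, h2, h3⟩ := leftSpecial_psiL hM a hx hx0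
  obtain ⟨y', h4, h5, h6⟩ := leftSpecial_psiL hM a hy hy0
  rcases h x' y' h1 h4 (by omega) (by omega) with h7 | h7
  · exact List.prefix_or_prefix_of_prefix (h3.trans (psiL_prefix_a h7)) h6
  · exact List.prefix_or_prefix_of_prefix h3 (h6.trans (psiL_prefix_a h7))

theorem ULS_psiW [DecidableEq A] {M : Set (List A)} (hM : FacClosed M) (u : List A) {n : ℕ}
    (h : ULS M n) : ULS (Img (psiW u) M) (n + u.length) := by
  induction u with
  | nil =>
    refine ULS_mono ?_ h
    rintro x ⟨m, hm, hx⟩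
    exact hM _ _ hx hm
  | cons a u ih =>
    refine ULS_mono ?_ (ULS_psiL (img_closed _ _) a ih)
    rintro x ⟨m, hm, hx⟩
    exact ⟨psiW u m, ⟨m, hm, List.infix_refl _⟩, hx⟩

theorem ULS_map {M : Set (List A)} (hM : FacClosed M) (π : Equiv.Perm A) {n : ℕ}
    (h : ULS M n) : ULS (Img (List.map π) M) n := by
  have key : ∀ x, x ∈ Img (List.map π) M → x.map π.symm ∈ M := by
    rintro x ⟨m, hm, hx⟩
    refine hM _ _ ?_ hm
    have := hx.map π.symm
    simpa using this
  have key2 : ∀ x, LeftSpecial (Img (List.map π) M) x → LeftSpecial M (x.map π.symm) := by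
    rintro x ⟨a, b, hab, h1, h2⟩
    exact ⟨π.symm a, π.symm b, by simpa using hab, by simpa using key _ h1, by simpa using key _ h2⟩
  intro x y hx hy hxn hyn
  rcases h _ _ (key2 x hx) (key2 y hy) (by simpa using hxn) (by simpa using hyn) with h1 | h1
  · left; simpa using h1.map π
  · right; simpa using h1.map π

theorem gcp_append [DecidableEq A] (x y z : List A) : gcp (x ++ y) (x ++ z) = x ++ gcp y z := by
  induction x with
  | nil => rfl
  | cons a x ih => simp [gcp, ih]

theorem gcs_append [DecidableEq A] (x y z : List A) : gcs (y ++ x) (z ++ x) = gcs y z ++ x := by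
  simp [gcs, gcp_append]

theorem gcp_nil_of [DecidableEq A] {x y : List A}
    (h : ∀ a b p q, x = a :: p → y = b :: q → a ≠ b) : gcp x y = [] := by
  cases x with
  | nil => simp [gcp]
  | cons a x =>
    cases y with
    | nil => simp [gcp]
    | cons b y => simp [gcp, h a b x y rfl rfl]

theorem gcs_nil_of [DecidableEq A] {x y : List A}
    (h : ∀ a b p q, x = p ++ [a] → y = q ++ [b] → a ≠ b) : gcs x y = [] := by
  unfold gcs
  rw [gcp_nil_of, List.reverse_nil]
  intro a b p q h1 h2
  apply h a b p.reverse q.reverse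
  · simpa using congrArg List.reverse h1
  · simpa using congrArg List.reverse h2

theorem gcs_conj [DecidableEq A] {w X Y X' Y' : List A} {a b : A} (hab : a ≠ b)
    (hX : w ++ X = X' ++ [a] ++ w) (hY : w ++ Y = Y' ++ [b] ++ w)
    (lX : w.length ≤ X.length) (lY : w.length ≤ Y.length) : gcs X Y = w := by
  obtain ⟨X1, rfl⟩ : w <:+ X :=
    List.suffix_of_suffix_length_le (l₃ := w ++ X) ⟨_, hX.symm⟩ (List.suffix_append _ _) lX
  obtain ⟨Y1, rfl⟩ : w <:+ Y :=
    List.suffix_of_suffix_length_le (l₃ := w ++ Y) ⟨_, hY.symm⟩ (List.suffix_append _ _) lY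
  rw [← List.append_assoc, List.append_cancel_right_eq] at hX hY
  rw [gcs_append, gcs_nil_of, List.nil_append]
  rintro c d p q rfl rfl
  rw [← List.append_assoc] at hX hY
  have h1 := (List.append_inj' hX rfl).2
  have h2 := (List.append_inj' hY rfl).2
  simp at h1 h2
  rw [h1, h2]; exact hab

theorem prefix_trichotomy : ∀ (r s : List A), r <+: s ∨ s <+: r ∨
    ∃ z a b r' s', a ≠ b ∧ r = z ++ a :: r' ∧ s = z ++ b :: s' := by
  intro r
  induction r with
  | nil => intro s; left; simp
  | cons a r ih =>
    intro s
    cases s with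
    | nil => right; left; simp
    | cons b s =>
      by_cases hab : a = b
      · subst hab
        rcases ih s with h | h | ⟨z, c, d, r', s', h1, h2, h3⟩
        · left; simpa using h
        · right; left; simpa using h
        · right; right; exact ⟨a :: z, c, d, r', s', h1, by simp [h2], by simp [h3]⟩
      · right; right; exact ⟨[], a, b, r, s, hab, rfl, rfl⟩

theorem suffix_trichotomy (r s : List A) : r <:+ s ∨ s <:+ r ∨
    ∃ z a b r' s', a ≠ b ∧ r = r' ++ [a] ++ z ∧ s = s' ++ [b] ++ z := by
  rcases prefix_trichotomy r.reverse s.reverse with h | h | ⟨z, c, d, r', s', h1, h2, h3⟩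
  · left; simpa using h
  · right; left; simpa using h
  · right; right
    refine ⟨z.reverse, c, d, r'.reverse, s'.reverse, h1, ?_, ?_⟩
    · simpa using congrArg List.reverse h2
    · simpa using congrArg List.reverse h3

theorem leftReturn_suffix {L : Set (List A)} {v r s : List A} (hr : r ∈ leftReturn L v)
    (hs : s ∈ leftReturn L v) (h : r <:+ s) : r = s := by
  obtain ⟨t, rfl⟩ := h
  by_contra hne
  obtain ⟨q, hq, h1⟩ := hr.2.1
  refine hs.2.2 ⟨t, q, ?_, hq, ?_⟩
  · rintro rfl; exact hne rfl
  · rw [List.append_assoc, h1, List.append_assoc]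

theorem hom_nil {σ : List A → List A} (h : IsListHom σ) : σ [] = [] := by
  have := h [] []
  simpa using this

theorem iter_hom {σ : List A → List A} (h : IsListHom σ) (n : ℕ) : IsListHom (σ^[n]) := by
  induction n with
  | zero => intro x y; rfl
  | succ n ih => intro x y; simp only [Function.iterate_succ_apply', ih x y, h _ _]

theorem hom_infix {σ : List A → List A} (h : IsListHom σ) {x y : List A} (hxy : x <:+: y) :
    σ x <:+: σ y := by
  obtain ⟨p, q, rfl⟩ := hxy
  exact ⟨σ p, σ q, by rw [h, h]⟩

theorem mem_singleton_infix {a : A} {x : List A} (h : a ∈ x) : [a] <:+: x := by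
  obtain ⟨p, q, rfl⟩ := List.append_of_mem h
  exact ⟨p, q, by simp⟩

theorem hom_len_two {τ : List A → List A} (h : IsListHom τ) {a b : A} (hab : a ≠ b)
    {y : List A} (ha : a ∈ y) (hb : b ∈ y) : (τ [a, b]).length ≤ (τ y).length := by
  have e : τ [a, b] = τ [a] ++ τ [b] := h [a] [b]
  obtain ⟨p, q, rfl⟩ := List.append_of_mem ha
  have e2 : τ (p ++ a :: q) = τ p ++ (τ [a] ++ τ q) := by rw [h, ← h [a] q]; rfl
  rw [e, e2]
  simp only [List.length_append]
  have : b ∈ p ∨ b ∈ q := by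
    simp at hb
    rcases hb with h | h | h
    · exact Or.inl h
    · exact absurd h.symm hab
    · exact Or.inr h
  rcases this with h1 | h1
  · have := (hom_infix h (mem_singleton_infix h1)).length_le; omega
  · have := (hom_infix h (mem_singleton_infix h1)).length_le; omega

end Helpers

section Main

variable {A : Type*} [DecidableEq A]

/-- the substitution ψ_u ∘ π -/
def tau (u : List A) (π : Equiv.Perm A) : List A → List A := fun x => psiW u (x.map π)

theorem tau_hom (u : List A) (π : Equiv.Perm A) : IsListHom (tau u π) := by
  intro x y; simp [tau, psiW_append]

theorem tau_last (u : List A) (π : Equiv.Perm A) (x : List A) (a : A) :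
    ∃ x', tau u π (x ++ [a]) = x' ++ [π a] := by
  obtain ⟨x', h⟩ := psiW_last u (x.map π) (π a)
  exact ⟨x', by rw [← h]; simp [tau]⟩

theorem conj_all {u : List A} {π : Equiv.Perm A} {w : List A} {σ : List A → List A}
    (hσhom : IsListHom σ) (hσ : ∀ a : A, psiW u [π a] ++ w = w ++ σ [a]) (x : List A) :
    tau u π x ++ w = w ++ σ x := by
  induction x with
  | nil => rw [hom_nil hσhom, hom_nil (tau_hom u π)]; simp
  | cons a x ih =>
    have e1 : tau u π (a :: x) = tau u π [a] ++ tau u π x := tau_hom u π [a] x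
    have e2 : σ (a :: x) = σ [a] ++ σ x := hσhom [a] x
    rw [e1, e2, List.append_assoc, ih, ← List.append_assoc, ← List.append_assoc, ← hσ a]
    rfl

theorem conj_len {u : List A} {π : Equiv.Perm A} {w : List A} {σ : List A → List A}
    (H : ∀ x, tau u π x ++ w = w ++ σ x) (x : List A) : (σ x).length = (tau u π x).length := by
  have := congrArg List.length (H x)
  simp at this; omega

/-- the conjugating word is shorter than images of words with two distinct letters -/
theorem w_short {u : List A} {π : Equiv.Perm A} {w : List A} {σ : List A → List A}
    (H : ∀ x, tau u π x ++ w = w ++ σ x) {a b : A} (hab : a ≠ b) {y : List A}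
    (ha : a ∈ y) (hb : b ∈ y) : w.length ≤ (tau u π y).length := by
  refine le_trans ?_ (hom_len_two (tau_hom u π) hab ha hb)
  by_contra hlt
  push Not at hlt
  have e1 : tau u π [a, b] = tau u π [a] ++ tau u π [b] := tau_hom u π [a] [b]
  have e2 : tau u π [b, a] = tau u π [b] ++ tau u π [a] := tau_hom u π [b] [a]
  have len : (tau u π [a, b]).length = (tau u π [b, a]).length := by
    rw [e1, e2]; simp; omega
  have p1 : tau u π [a, b] <+: w :=
    List.prefix_of_prefix_length_le (l₃ := w ++ σ [a, b]) ⟨w, H _⟩ (List.prefix_append _ _) hlt.le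
  have p2 : tau u π [b, a] <+: w :=
    List.prefix_of_prefix_length_le (l₃ := w ++ σ [b, a]) ⟨w, H _⟩ (List.prefix_append _ _)
      (by omega)
  have eq : tau u π [a, b] = tau u π [b, a] :=
    (List.prefix_of_prefix_length_le p1 p2 len.le).eq_of_length len
  obtain ⟨x', h1⟩ := tau_last u π [a] b
  obtain ⟨y', h2⟩ := tau_last u π [b] a
  have eq' : x' ++ [π b] = y' ++ [π a] := by rw [← h1, ← h2]; exact eq
  have := (List.append_inj' eq' rfl).2
  simp at this
  exact hab this.symm

theorem langS_closed (σ : List A → List A) : FacClosed (LangS σ) := by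
  rintro x y h ⟨n, a, hinf⟩
  exact ⟨n, a, h.trans hinf⟩

theorem sigma_ne_nil {u : List A} {π : Equiv.Perm A} {w : List A} {σ : List A → List A}
    (H : ∀ x, tau u π x ++ w = w ++ σ x) {x : List A} (hx : x ≠ []) : σ x ≠ [] := by
  have hl := conj_len H x
  obtain ⟨y, a, rfl⟩ := List.eq_nil_or_concat x |>.resolve_left hx
  obtain ⟨x', h⟩ := tau_last u π y a
  intro h0
  rw [h0, List.concat_eq_append, h] at hl
  simp at hl

theorem iter_ne_nil {σ : List A → List A} (H : ∀ x, x ≠ [] → σ x ≠ []) (n : ℕ) {x : List A}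
    (hx : x ≠ []) : σ^[n] x ≠ [] := by
  induction n with
  | zero => exact hx
  | succ n ih => rw [Function.iterate_succ_apply']; exact H _ ih

/-- Every word of the language extends to the right by a word with all letters. -/
theorem langS_extend {σ : List A → List A} (hhom : IsListHom σ) (hne : ∀ x, x ≠ [] → σ x ≠ [])
    (hprim : IsPrimitiveSubst σ) {a0 b0 : A} (hab : a0 ≠ b0) {x : List A} (hx : x ∈ LangS σ) :
    ∃ y, x ++ y ∈ LangS σ ∧ ∀ c, c ∈ y := by
  obtain ⟨k, hk, hp⟩ := hprim
  obtain ⟨n, a, hxn⟩ := hx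
  obtain ⟨d1, d2, rest, hd⟩ : ∃ d1 d2 rest, σ^[k] [a0] = d1 :: d2 :: rest := by
    have h1 := hp a0 a0
    have h2 := hp a0 b0
    match h : σ^[k] [a0] with
    | [] => rw [h] at h1; simp at h1
    | [t] => rw [h] at h1 h2; simp at h1 h2; exact absurd (h1.trans h2.symm) hab
    | d1 :: d2 :: rest => exact ⟨_, _, _, rfl⟩
  have h1 : x <:+: σ^[n + k] [d1] := by
    rw [Function.iterate_add_apply]
    exact hxn.trans (hom_infix (iter_hom hhom n) (mem_singleton_infix (hp d1 a)))
  obtain ⟨p, q, h2⟩ := h1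
  refine ⟨q ++ σ^[n + k] [d2], ⟨n + k + k, a0, ?_⟩, ?_⟩
  · rw [Function.iterate_add_apply _ (n + k) k, hd]
    have e : σ^[n + k] (d1 :: d2 :: rest) = σ^[n + k] [d1] ++ (σ^[n + k] [d2] ++ σ^[n + k] rest) := by
      rw [← iter_hom hhom, ← iter_hom hhom]; rfl
    rw [e, ← h2]
    exact ⟨p, σ^[n + k] rest, by simp⟩
  · intro c
    have : c ∈ σ^[n + k] [d2] := by
      rw [Nat.add_comm, Function.iterate_add_apply]
      obtain ⟨t, l, ht⟩ := List.exists_cons_of_ne_nil (iter_ne_nil hne n (x := [d2]) (by simp))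
      rw [ht]
      exact (hom_infix (iter_hom hhom k) (x := [t]) (y := t :: l) ⟨[], l, by simp⟩).subset (hp t c)
    simp [this]

theorem langS_ULS {u : List A} (hu : u ≠ []) {π : Equiv.Perm A} {w : List A} {σ : List A → List A}
    (hhom : IsListHom σ) (H : ∀ x, tau u π x ++ w = w ++ σ x)
    (hprim : IsPrimitiveSubst σ) {a0 b0 : A} (hab : a0 ≠ b0) (n : ℕ) : ULS (LangS σ) n := by
  have hne : ∀ x, x ≠ [] → σ x ≠ [] := fun x hx => sigma_ne_nil H hx
  have sub : LangS σ ⊆ Img (psiW u) (Img (List.map π) (LangS σ)) := by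
    intro x hx
    obtain ⟨m, hm, hxm⟩ : ∃ m ∈ LangS σ, x <:+: σ m := by
      obtain ⟨j, a, hj⟩ := hx
      cases j with
      | zero =>
        obtain ⟨k, hk, hp⟩ := hprim
        obtain ⟨k, rfl⟩ : ∃ k', k = k' + 1 := ⟨k - 1, by omega⟩
        refine ⟨σ^[k] [a], ⟨k, a, List.infix_refl _⟩, ?_⟩
        rw [← Function.iterate_succ_apply' σ]
        exact hj.trans (mem_singleton_infix (hp a a))
      | succ j =>
        refine ⟨σ^[j] [a], ⟨j, a, List.infix_refl _⟩, ?_⟩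
        rw [← Function.iterate_succ_apply' σ]
        exact hj
    obtain ⟨y, hy, hall⟩ := langS_extend hhom hne hprim hab hm
    refine ⟨(m ++ y).map π, ⟨m ++ y, hy, List.infix_refl _⟩, ?_⟩
    change x <:+: tau u π (m ++ y)
    have hwy : w <+: tau u π y :=
      List.prefix_of_prefix_length_le (l₃ := w ++ σ y) (List.prefix_append _ _) ⟨w, H y⟩
        (w_short H hab (hall a0) (hall b0))
    obtain ⟨t, ht⟩ := hwy
    rw [tau_hom u π, ← ht, ← List.append_assoc, H m]
    exact hxm.trans ⟨w, t, by simp⟩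
  induction n with
  | zero =>
    intro x y _ _ hx _
    left
    have : x = [] := by simpa using hx
    simp [this]
  | succ n ih =>
    have h1 := ULS_psiW (img_closed _ _) u (ULS_map (langS_closed σ) π ih)
    have h2 := ULS_mono sub h1
    have : 1 ≤ u.length := List.length_pos_iff.mpr hu
    exact fun x y hx hy hxn hyn => h2 x y hx hy (by omega) (by omega)

end Main

/-- for distinct left return words r ≠ s to v,
`|gcs(σ(r)σ(s), σ(s)σ(r))| ≥ |w|`, with equality iff v is left special. -/
theorem gcs_image_return_words_ge_index {A : Type*} [Fintype A] [DecidableEq A]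
    (hA : 1 < Fintype.card A) (u : List A) (hu : u ≠ []) (π : Equiv.Perm A)
    (w : List A) (hw : w <+: pal u)
    (σ : List A → List A) (hσhom : IsListHom σ)
    (hσ : ∀ a : A, psiW u [π a] ++ w = w ++ σ [a])
    (hprim : IsPrimitiveSubst σ)
    (v : List A) (hv : v ∈ LangS σ)
    (r s : List A) (hr : r ∈ leftReturn (LangS σ) v) (hs : s ∈ leftReturn (LangS σ) v)
    (hrs : r ≠ s) :
    w.length ≤ (gcs (σ r ++ σ s) (σ s ++ σ r)).length ∧
    ((gcs (σ r ++ σ s) (σ s ++ σ r)).length = w.length ↔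
      LeftSpecial (LangS σ) v) := by
  classical
  obtain ⟨a0, b0, hab0⟩ := Fintype.one_lt_card_iff.mp hA
  have H := conj_all hσhom hσ
  rcases suffix_trichotomy r s with h | h | ⟨z, a, b, r', s', hab, er, es⟩
  · exact absurd (leftReturn_suffix hr hs h) hrs
  · exact absurd (leftReturn_suffix hs hr h).symm hrs
  have e1 : σ r ++ σ s = σ (r ++ s' ++ [b]) ++ σ z := by
    rw [← hσhom, ← hσhom, es]; simp
  have e2 : σ s ++ σ r = σ (s ++ r' ++ [a]) ++ σ z := by
    rw [← hσhom, ← hσhom, er]; simp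
  obtain ⟨X', hX'⟩ := tau_last u π (r ++ s') b
  obtain ⟨Y', hY'⟩ := tau_last u π (s ++ r') a
  have hg : gcs (σ (r ++ s' ++ [b])) (σ (s ++ r' ++ [a])) = w := by
    refine gcs_conj (a := π b) (b := π a) (fun h => hab (π.injective h).symm)
      (by rw [← H, hX']) (by rw [← H, hY']) ?_ ?_
    · rw [conj_len H]
      exact w_short H hab (by simp [er]) (by simp)
    · rw [conj_len H]
      exact w_short H hab (by simp) (by simp [es])
  have hlen : (gcs (σ r ++ σ s) (σ s ++ σ r)).length = w.length + (σ z).length := by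
    rw [e1, e2, gcs_append, hg, List.length_append]
  refine ⟨by omega, ?_⟩
  have hav : a :: (z ++ v) ∈ LangS σ :=
    langS_closed σ _ _ ⟨r', [], by rw [er]; simp⟩ hr.1
  have hbv : b :: (z ++ v) ∈ LangS σ :=
    langS_closed σ _ _ ⟨s', [], by rw [es]; simp⟩ hs.1
  constructor
  · intro h
    have hz : z = [] := by
      by_contra hz
      have := List.length_pos_iff.mpr (sigma_ne_nil H hz)
      omega
    subst hz
    exact ⟨a, b, hab, hav, hbv⟩
  · intro hls
    have hz : z = [] := by
      by_contra hz
      have hzl := List.length_pos_iff.mpr hz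
      have hpre : v <+: z ++ v := by
        rcases langS_ULS hu hσhom H hprim hab0 (z ++ v).length v (z ++ v) hls
          ⟨a, b, hab, hav, hbv⟩ (by simp) le_rfl with h | h
        · exact h
        · have := h.length_le
          simp at this
          exact absurd this hz
      obtain ⟨q, hq⟩ := hpre
      refine hr.2.2 ⟨r' ++ [a], q, by simp, ?_, ?_⟩
      · rintro rfl
        have := congrArg List.length hq
        simp at this
        exact hz this
      · rw [er, List.append_assoc, ← hq, List.append_assoc (r' ++ [a])]
    rw [hlen, hz, hom_nil hσhom]
    simp
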